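/- Let G̃ be an enhanced graph with a non-split 5-configuration S̃, and suppose G̃ is minor-minimal subject to having a non-split 5-configuration (i.e., in every proper enhanced minor of G̃ every 5-configuration splits). Then: (1) every contract-proof edge and every delete-proof edge of G̃ belongs to S̃; (2) every separation (A,B) of G̃ of order at most 3 with A ∩ S̃ = ∅ satisfies |A| ≤ 3. -/

import Mathlib

/-!  Common definitions: multigraphs, separations, width, minors,
Kirchhoff/Dodgson polynomials, Feynman 5-splitting, enhanced graphs. -/

noncomputable section

attribute [local instance] Classical.propDecidable

/-- A finite multigraph, given by finite vertex and edge types together with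
source and target maps (an arbitrary orientation of each edge). -/
structure Multigraph : Type 1 where
  V : Type
  E : Type
  [fintypeV : Fintype V]
  [fintypeE : Fintype E]
  src : E → V
  tgt : E → V

attribute [instance] Multigraph.fintypeV Multigraph.fintypeE

namespace Multigraph

variable (G : Multigraph)

/-- The endpoints of an edge as an unordered pair. -/
def ends (e : G.E) : Sym2 G.V := s(G.src e, G.tgt e)

/-- Incidence of a vertex with an edge. -/
def inc (v : G.V) (e : G.E) : Prop := v = G.src e ∨ v = G.tgt e

/-- `V(G_A)`: the vertices of the subgraph induced by an edge set `A`. -/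
def edgeVerts (A : Set G.E) : Set G.V := {v | ∃ e ∈ A, G.inc v e}

/-- The order of the separation `(A, Aᶜ)` of the graph `G`,
i.e. `|V(G_A) ∩ V(G_B)|` where `B = Aᶜ`. -/
def sepOrder (A : Set G.E) : ℕ := (G.edgeVerts A ∩ G.edgeVerts Aᶜ).ncard

/-- One step along an edge belonging to the edge set `A`. -/
def stepOn (A : Set G.E) (a b : G.V) : Prop :=
  ∃ e ∈ A, (G.src e = a ∧ G.tgt e = b) ∨ (G.src e = b ∧ G.tgt e = a)

/-- Reachability using only edges in `A`. -/
def reachOn (A : Set G.E) : G.V → G.V → Prop := Relation.ReflTransGen (G.stepOn A)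

/-- Adjacency. -/
def Adj (a b : G.V) : Prop := G.stepOn Set.univ a b

/-- One adjacency step staying inside the vertex set `U`. -/
def stepWithin (U : Set G.V) (a b : G.V) : Prop := a ∈ U ∧ b ∈ U ∧ G.Adj a b

/-- The subgraph induced by the vertex set `U` is (nonempty and) connected. -/
def ConnectedWithin (U : Set G.V) : Prop :=
  U.Nonempty ∧ ∀ a ∈ U, ∀ b ∈ U, Relation.ReflTransGen (G.stepWithin U) a b

/-- Connectivity of the multigraph. -/
def Connected : Prop := G.ConnectedWithin Set.univ

/-- A multigraph is simple if it has no loops and no parallel edges. -/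
def Simple : Prop := (∀ e : G.E, G.src e ≠ G.tgt e) ∧ Function.Injective G.ends

/-- 3-connectivity: at least 4 vertices, and removing fewer than 3 vertices
leaves a connected graph. -/
def ThreeConnected : Prop :=
  4 ≤ Fintype.card G.V ∧ ∀ S : Set G.V, S.ncard < 3 → G.ConnectedWithin Sᶜ

/-- The spanning subgraph with edge set `T` is connected. -/
def ConnectedOn (T : Set G.E) : Prop := ∀ a b : G.V, G.reachOn T a b

/-- The degree of `v` in the spanning subgraph with edge set `T`
(loops count twice). -/
def degOn (T : Set G.E) (v : G.V) : ℕ :=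
  ({e ∈ T | G.src e = v}).ncard + ({e ∈ T | G.tgt e = v}).ncard

/-- The degree of a vertex (loops count twice). -/
def degree (v : G.V) : ℕ := G.degOn Set.univ v

/-- An edge set is a forest (contains no cycle) iff every nonempty subset
has a vertex of degree exactly one. -/
def IsForest (T : Set G.E) : Prop :=
  ∀ T' ⊆ T, T'.Nonempty → ∃ v : G.V, G.degOn T' v = 1

/-- `T` is the edge set of a spanning tree of `G`. -/
def IsSpanningTree (T : Set G.E) : Prop := G.IsForest T ∧ G.ConnectedOn T

/-- The rank of an edge set in the cycle matroid `M(G)`: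
the size of a largest forest contained in it. -/
def rk (A : Set G.E) : ℕ := sSup {n | ∃ T ⊆ A, G.IsForest T ∧ T.ncard = n}

/-- The order of the separation `(A, Aᶜ)` in the cycle matroid `M(G)`,
namely `r(A) + r(Aᶜ) - r(E) + 1`. -/
def msepOrder (A : Set G.E) : ℕ := G.rk A + G.rk Aᶜ + 1 - G.rk Set.univ

/-- The number of connected components of `G_A`, the subgraph induced by the
edge set `A`. -/
def ncompOn (A : Set G.E) : ℕ :=
  ({C : Set G.V | ∃ v ∈ G.edgeVerts A, C = {w | G.reachOn A v w}}).ncard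

/-- `G` has an edge ordering of width at most `k`: every prefix/suffix
separation has order at most `k`. -/
def WidthLE (k : ℕ) : Prop :=
  ∃ f : Fin (Fintype.card G.E) ≃ G.E,
    ∀ ℓ : ℕ,
      G.sepOrder {e | ∃ i : Fin (Fintype.card G.E), f i = e ∧ (i : ℕ) < ℓ} ≤ k

/-- The width of `G`: the minimum width of an edge ordering. -/
def width : ℕ := sInf {k | G.WidthLE k}

/-- The minor of `G` obtained by deleting the edges in `D` and contracting the
edges in `C`. -/
def minorDC (D C : Set G.E) : Multigraph :=
  let rel : G.V → G.V → Prop := fun a b => ∃ e ∈ C, G.src e = a ∧ G.tgt e = b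
  { V := Quot rel
    E := {e : G.E // e ∉ D ∪ C}
    fintypeV := @Fintype.ofFinite _ (Finite.of_surjective (Quot.mk rel) fun q => Quot.exists_rep q)
    fintypeE := Fintype.ofFinite _
    src := fun e => Quot.mk rel (G.src e.1)
    tgt := fun e => Quot.mk rel (G.tgt e.1) }

/-- Deletion of a vertex (together with all incident edges). -/
def deleteVertex (v : G.V) : Multigraph :=
  { V := {w : G.V // w ≠ v}
    E := {e : G.E // ¬ G.inc v e}
    fintypeV := Fintype.ofFinite _
    fintypeE := Fintype.ofFinite _
    src := fun e => ⟨G.src e.1, fun h => e.2 (Or.inl h.symm)⟩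
    tgt := fun e => ⟨G.tgt e.1, fun h => e.2 (Or.inr h.symm)⟩ }

/-- The edges having one endpoint in `X` and the other in `Y`. -/
def crossEdges (X Y : Set G.V) : Set G.E :=
  {e | (G.src e ∈ X ∧ G.tgt e ∈ Y) ∨ (G.src e ∈ Y ∧ G.tgt e ∈ X)}

/-- `G` has `R` as a minor, via branch sets. -/
def HasMinor (R : Multigraph) : Prop :=
  ∃ X : R.V → Set G.V,
    (∀ v : R.V, G.ConnectedWithin (X v)) ∧
    (Pairwise fun v w => Disjoint (X v) (X w)) ∧
    ∀ v w : R.V, v ≠ w →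
      ({f : R.E | R.ends f = s(v, w)}).ncard ≤ (G.crossEdges (X v) (X w)).ncard

/-- `D` is the edge set of a cycle of `G`. -/
def IsCycleSet (D : Set G.E) : Prop :=
  D.Nonempty ∧ (∀ v ∈ G.edgeVerts D, G.degOn D v = 2) ∧
    ∀ a ∈ G.edgeVerts D, ∀ b ∈ G.edgeVerts D, G.reachOn D a b

/-- The side `A` of a separation on `X` is rich: for every `x ∈ X` there is a
cycle `D` avoiding `x` with at most one edge outside `A`. -/
def Rich (A : Set G.E) (X : Set G.V) : Prop :=
  ∀ x ∈ X, ∃ D : Set G.E, G.IsCycleSet D ∧ x ∉ G.edgeVerts D ∧ (D \ A).ncard ≤ 1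

/-- The entry of the (edge × vertex) incidence matrix, as a polynomial. -/
def incCol (e : G.E) (v : G.V) : MvPolynomial G.E ℤ :=
  (if G.src e = v then 1 else 0) - (if G.tgt e = v then 1 else 0)

/-- The expanded Kirchhoff matrix `M_G` (with the column of `v0` deleted). -/
def bigMatrix (v0 : G.V) :
    Matrix (G.E ⊕ {v : G.V // v ≠ v0}) (G.E ⊕ {v : G.V // v ≠ v0}) (MvPolynomial G.E ℤ) :=
  Matrix.of fun r c =>
    match r, c with
    | Sum.inl e, Sum.inl f => if e = f then MvPolynomial.X e else 0
    | Sum.inl e, Sum.inr v => G.incCol e v.1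
    | Sum.inr v, Sum.inl e => - G.incCol e v.1
    | Sum.inr _, Sum.inr _ => 0

/-- The Dodgson polynomial `Ψ^{I,J}_K`: delete the rows indexed by `I` and the
columns indexed by `J` from `M_G`, take the determinant, and set `x_e = 0`
for `e ∈ K`.  (It is well defined up to an overall sign.) -/
def dodgson (v0 : G.V) (I J K : Set G.E) : MvPolynomial G.E ℤ :=
  if h : Nonempty ({e : G.E // e ∉ I} ≃ {e : G.E // e ∉ J}) then
    MvPolynomial.aeval (fun e => if e ∈ K then (0 : MvPolynomial G.E ℤ) else MvPolynomial.X e)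
      (Matrix.det (Matrix.of fun r c =>
        G.bigMatrix v0 (Sum.map Subtype.val id r) (Sum.map (fun x => (h.some x).1) id c)))
  else 0

/-- `(I,J,K)` is one of the 30 Dodgson configurations associated with the
5-configuration `S`. -/
def DodgsonConfig (S I J K : Set G.E) : Prop :=
  I ∪ J ∪ K = S ∧
    ((I.ncard = 2 ∧ J.ncard = 2 ∧ K.ncard = 1 ∧ I ∩ J = ∅ ∧ I ∩ K = ∅ ∧ J ∩ K = ∅) ∨
      (I.ncard = 3 ∧ J.ncard = 3 ∧ K = ∅ ∧ (I ∩ J).ncard = 1))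

/-- The 5-configuration `S` splits: one of its 30 associated Dodgson
polynomials is identically zero. -/
def ConfigSplits (S : Set G.E) : Prop :=
  ∃ I J K : Set G.E, G.DodgsonConfig S I J K ∧ ∀ v0 : G.V, G.dodgson v0 I J K = 0

/-- `G` is Feynman 5-split: every 5-configuration splits. -/
def FeynmanSplit : Prop := ∀ S : Set G.E, S.ncard = 5 → G.ConfigSplits S

/-- `(U, F)` is a subgraph of `G` (every edge of `F` has both ends in `U`). -/
def IsSubgraphPair (U : Set G.V) (F : Set G.E) : Prop :=
  ∀ e ∈ F, G.src e ∈ U ∧ G.tgt e ∈ U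

/-- `G` decomposes into edge-disjoint subgraphs `G₁ ∪ G₂ = G` with
`|V(G₁) ∩ V(G₂)| ≤ 2` and `|E(G₁) ∩ S| = 2`, or with
`|V(G₁) ∩ V(G₂)| = 1` and `|E(G₁) ∩ S| = 1`. -/
def splitWitness (S : Set G.E) : Prop :=
  ∃ (U1 U2 : Set G.V) (F1 F2 : Set G.E),
    G.IsSubgraphPair U1 F1 ∧ G.IsSubgraphPair U2 F2 ∧
    Disjoint F1 F2 ∧ U1 ∪ U2 = Set.univ ∧ F1 ∪ F2 = Set.univ ∧
    (((U1 ∩ U2).ncard ≤ 2 ∧ (F1 ∩ S).ncard = 2) ∨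
      ((U1 ∩ U2).ncard = 1 ∧ (F1 ∩ S).ncard = 1))

/-- A separation of order at most 1 with edges of `S` on both sides, or a
("bad") 2-separation with `min{|A ∩ S|, |B ∩ S|} = 2`. -/
def badSplitSep (S : Set G.E) : Prop :=
  ∃ A : Set G.E,
    (G.sepOrder A ≤ 1 ∧ (A ∩ S).Nonempty ∧ (Aᶜ ∩ S).Nonempty) ∨
      (G.sepOrder A = 2 ∧ min (A ∩ S).ncard (Aᶜ ∩ S).ncard = 2)

/-- Isomorphism of multigraphs. -/
def IsoTo (G' : Multigraph) : Prop :=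
  ∃ (α : G.V ≃ G'.V) (β : G.E ≃ G'.E),
    ∀ e : G.E, G'.ends (β e) = Sym2.map α (G.ends e)

/-- `G` is a tree. -/
def IsTree : Prop := G.Connected ∧ G.IsForest Set.univ

/-- Every vertex has degree 1 or 3. -/
def IsCubic : Prop := ∀ v : G.V, G.degree v = 1 ∨ G.degree v = 3

/-- A leaf. -/
def IsLeaf (v : G.V) : Prop := G.degree v = 1

/-- A cubic caterpillar: a cubic tree whose non-leaf vertices induce a path. -/
def IsCubicCaterpillar : Prop :=
  G.IsTree ∧ G.IsCubic ∧
    (∀ a ∈ {v : G.V | ¬ G.IsLeaf v}, ∀ b ∈ {v : G.V | ¬ G.IsLeaf v},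
      Relation.ReflTransGen (G.stepWithin {v : G.V | ¬ G.IsLeaf v}) a b) ∧
    ∀ v : G.V, ¬ G.IsLeaf v →
      ({e : G.E | G.inc v e ∧ ∃ w : G.V, ¬ G.IsLeaf w ∧ G.inc w e ∧ w ≠ v}).ncard ≤ 2

/-- The branch decomposition `(T, φ)` of the cycle matroid `M(G)` has width at
most `k`: removing any edge `f` of `T` gives a separation of the ground set
of matroid order at most `k`. -/
def branchWidthLE (T : Multigraph) (φ : G.E → T.V) (k : ℕ) : Prop :=
  ∀ f : T.E,
    G.msepOrder {e : G.E | φ e ∈ {x : T.V | T.reachOn {f}ᶜ (T.src f) x}} ≤ k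

/-- `(T, φ)` is a branch decomposition of `M(G)` over a cubic caterpillar. -/
def IsCatDecomp (T : Multigraph) (φ : G.E → T.V) : Prop :=
  T.IsCubicCaterpillar ∧ Function.Injective φ ∧ ∀ e : G.E, T.IsLeaf (φ e)

/-- The caterpillar width of the cycle matroid `M(G)`. -/
def catWidth : ℕ :=
  sInf {k | ∃ (T : Multigraph) (φ : G.E → T.V), G.IsCatDecomp T φ ∧ G.branchWidthLE T φ k}

end Multigraph

/-! ### Concrete graphs -/

/-- The complete graph `K₅`. -/
def K5m : Multigraph where
  V := Fin 5
  E := {p : Fin 5 × Fin 5 // p.1 < p.2}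
  src := fun e => e.1.1
  tgt := fun e => e.1.2

/-- The complete bipartite graph `K₃,₃`. -/
def K33m : Multigraph where
  V := Fin 3 ⊕ Fin 3
  E := Fin 3 × Fin 3
  src := fun e => Sum.inl e.1
  tgt := fun e => Sum.inr e.2

/-- The cube (3-dimensional hypercube) graph `C`. -/
def cubeM : Multigraph where
  V := Fin 2 × Fin 2 × Fin 2
  E := Fin 3 × Fin 2 × Fin 2
  src := fun e =>
    if e.1 = 0 then (0, e.2.1, e.2.2) else if e.1 = 1 then (e.2.1, 0, e.2.2)
      else (e.2.1, e.2.2, 0)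
  tgt := fun e =>
    if e.1 = 0 then (1, e.2.1, e.2.2) else if e.1 = 1 then (e.2.1, 1, e.2.2)
      else (e.2.1, e.2.2, 1)

/-- The octahedron graph `O = K₂,₂,₂`. -/
def octaM : Multigraph where
  V := Fin 3 × Fin 2
  E := {p : (Fin 3 × Fin 2) × (Fin 3 × Fin 2) // p.1.1 < p.2.1}
  src := fun e => e.1.1
  tgt := fun e => e.1.2

/-- The edges of the graph `H` (the cube after a Y–Δ transformation at one
vertex): vertices `0,1,2` form the new triangle, `6` is the antipodal vertex. -/
def hEdgeList : List (Fin 7 × Fin 7) :=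
  [(0,1), (0,2), (1,2), (0,3), (0,4), (1,3), (1,5), (2,4), (2,5), (3,6), (4,6), (5,6)]

/-- The graph `H`, one Δ–Y away from each of the cube and the octahedron. -/
def Hm : Multigraph where
  V := Fin 7
  E := {p : Fin 7 × Fin 7 // p ∈ hEdgeList}
  src := fun e => e.1.1
  tgt := fun e => e.1.2

/-- The complete graph `K₄`. -/
def K4m : Multigraph where
  V := Fin 4
  E := {p : Fin 4 × Fin 4 // p.1 < p.2}
  src := fun e => e.1.1
  tgt := fun e => e.1.2

/-- `K₅⁻`, the complete graph on 5 vertices minus the edge `{3,4}`. -/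
def K5minusM : Multigraph where
  V := Fin 5
  E := {p : Fin 5 × Fin 5 // p.1 < p.2 ∧ ¬(p.1 = 3 ∧ p.2 = 4)}
  src := fun e => e.1.1
  tgt := fun e => e.1.2

/-- The wheel `W_k`: centre `none`; rim edges `Sum.inl i` join `some i` to
`some (i+1)`, spoke edges `Sum.inr i` join the centre to `some i`. -/
def wheelM (k : ℕ) : Multigraph where
  V := Option (Fin k)
  E := Fin k ⊕ Fin k
  src := Sum.elim (fun i => some i) (fun _ => none)
  tgt := Sum.elim (fun i => some (finRotate k i)) (fun i => some i)

/-! ### Enhanced graphs -/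

/-- An enhanced graph: a graph together with sets of contract-proof and
delete-proof edges. -/
structure EGraph : Type 1 where
  G : Multigraph
  Cp : Set G.E
  Dp : Set G.E

namespace EGraph

/-- The 5-configuration `S` of an enhanced graph splits. -/
def Splits (H : EGraph) (S : Set H.G.E) : Prop :=
  H.G.badSplitSep S ∨
    (∃ f ∈ S \ H.Dp, (H.G.minorDC {f} ∅).badSplitSep {e | e.1 ∈ S}) ∨
    (∃ f ∈ S \ H.Cp, (H.G.minorDC ∅ {f}).badSplitSep {e | e.1 ∈ S})

/-- An enhanced graph is non-split if it has a non-split 5-configuration. -/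
def NonSplit (H : EGraph) : Prop := ∃ S : Set H.G.E, S.ncard = 5 ∧ ¬ H.Splits S

/-- Deletion of an edge. -/
def delE (H : EGraph) (f : H.G.E) : EGraph :=
  ⟨H.G.minorDC {f} ∅, {e | e.1 ∈ H.Cp}, {e | e.1 ∈ H.Dp}⟩

/-- Contraction of an edge. -/
def conE (H : EGraph) (f : H.G.E) : EGraph :=
  ⟨H.G.minorDC ∅ {f}, {e | e.1 ∈ H.Cp}, {e | e.1 ∈ H.Dp}⟩

/-- Deletion of a vertex. -/
def delV (H : EGraph) (v : H.G.V) : EGraph :=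
  ⟨H.G.deleteVertex v, {e | e.1 ∈ H.Cp}, {e | e.1 ∈ H.Dp}⟩

/-- Remove an edge from the contract-proof set. -/
def unprotC (H : EGraph) (f : H.G.E) : EGraph := ⟨H.G, H.Cp \ {f}, H.Dp⟩

/-- Remove an edge from the delete-proof set. -/
def unprotD (H : EGraph) (f : H.G.E) : EGraph := ⟨H.G, H.Cp, H.Dp \ {f}⟩

/-- Delete `f'` of a parallel pair `f, f'` and make `f` delete-proof. -/
def parallelReduce (H : EGraph) (f f' : H.G.E) : EGraph :=
  ⟨H.G.minorDC {f'} ∅, {e | e.1 ∈ H.Cp}, {e | e.1 ∈ H.Dp ∨ e.1 = f}⟩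

/-- Contract `f'` of the two edges `f, f'` at a degree-two vertex and make
`f` contract-proof. -/
def seriesReduce (H : EGraph) (f f' : H.G.E) : EGraph :=
  ⟨H.G.minorDC ∅ {f'}, {e | e.1 ∈ H.Cp ∨ e.1 = f}, {e | e.1 ∈ H.Dp}⟩

/-- One step of the enhanced-graph minor relation. -/
inductive MinorStep : EGraph → EGraph → Prop
  | delV (H : EGraph) (v : H.G.V) : MinorStep H (H.delV v)
  | delE (H : EGraph) (f : H.G.E) : MinorStep H (H.delE f)
  | conE (H : EGraph) (f : H.G.E) : MinorStep H (H.conE f)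
  | unprotC (H : EGraph) (f : H.G.E) (hf : f ∈ H.Cp) : MinorStep H (H.unprotC f)
  | unprotD (H : EGraph) (f : H.G.E) (hf : f ∈ H.Dp) : MinorStep H (H.unprotD f)
  | parallel (H : EGraph) (f f' : H.G.E) (hne : f ≠ f')
      (hpar : H.G.ends f = H.G.ends f') : MinorStep H (H.parallelReduce f f')
  | series (H : EGraph) (f f' : H.G.E) (v : H.G.V) (hne : f ≠ f')
      (hf : H.G.inc v f) (hf' : H.G.inc v f')
      (hdeg : ∀ e : H.G.E, H.G.inc v e → e = f ∨ e = f') :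
      MinorStep H (H.seriesReduce f f')

/-- Minor-minimal non-split enhanced graph: non-split, but every proper
enhanced minor is split. -/
def MinorMinimalNonSplit (H : EGraph) : Prop :=
  H.NonSplit ∧ ∀ H' : EGraph, Relation.TransGen MinorStep H H' → ¬ H'.NonSplit

/-- Isomorphism of enhanced graphs. -/
def IsoTo (H H' : EGraph) : Prop :=
  ∃ (α : H.G.V ≃ H'.G.V) (β : H.G.E ≃ H'.G.E),
    (∀ e : H.G.E, H'.G.ends (β e) = Sym2.map α (H.G.ends e)) ∧
    (∀ e : H.G.E, β e ∈ H'.Cp ↔ e ∈ H.Cp) ∧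
    (∀ e : H.G.E, β e ∈ H'.Dp ↔ e ∈ H.Dp)

end EGraph

/-- The edge `01` of `K₄`. -/
def e01K4 : K4m.E := ⟨(0, 1), by decide⟩

/-- The enhanced graph `K₄(1)`: all edges of `K₄` except one are both
contract-proof and delete-proof. -/
def K4one : EGraph := ⟨K4m, {e | e ≠ e01K4}, {e | e ≠ e01K4}⟩

/-! ### The statement -/

open Multigraph

/-! ### Separations of edge-labelled incidence data

A graph is represented by maps `s t : E → W` and a set `F` of edges that are
present; this makes the minors of a fixed graph live on the same edge type. -/

namespace EdgeSep

variable {E W : Type*}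

/-- The vertices met by the edge set `P`. -/
def verts (s t : E → W) (P : Set E) : Set W := {w | ∃ e ∈ P, w = s e ∨ w = t e}

/-- The boundary of the separation of the edge set `F` into `F ∩ P` and `F \ P`. -/
def bd (s t : E → W) (F P : Set E) : Set W := verts s t (F ∩ P) ∩ verts s t (F \ P)

/-- The edge set `F` has a separation that witnesses splitting of `S`. -/
def Bad (s t : E → W) (F S : Set E) : Prop :=
  ∃ P : Set E,
    ((bd s t F P).ncard ≤ 1 ∧ (F ∩ P ∩ S).Nonempty ∧ (F \ P ∩ S).Nonempty) ∨
      ((bd s t F P).ncard ≤ 2 ∧ min (F ∩ P ∩ S).ncard (F \ P ∩ S).ncard = 2)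

/-- Identify the vertex `v` with `u`. -/
def merge (u v x : W) : W := if x = v then u else x

lemma merge_of_ne {u v x : W} (h : x ≠ v) : merge u v x = x := if_neg h

lemma merge_right (u v : W) : merge u v v = u := if_pos rfl

lemma merge_left (u v : W) : merge u v u = u := by
  unfold merge; split_ifs <;> rfl

lemma verts_mono {s t : E → W} {P Q : Set E} (h : P ⊆ Q) : verts s t P ⊆ verts s t Q :=
  fun _ ⟨e, he, hw⟩ => ⟨e, h he, hw⟩

lemma mem_verts_merge {s t : E → W} {Q : Set E} {x : E} {u v y : W} (hx : x ∈ Q)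
    (hy : y = s x ∨ y = t x) :
    merge u v y ∈ verts (merge u v ∘ s) (merge u v ∘ t) Q :=
  ⟨x, hx, hy.imp (congrArg _) (congrArg _)⟩

lemma verts_finite [Finite E] (s t : E → W) (P : Set E) : (verts s t P).Finite := by
  refine ((Set.finite_range s).union (Set.finite_range t)).subset ?_
  rintro w ⟨e, -, rfl | rfl⟩
  exacts [Or.inl ⟨e, rfl⟩, Or.inr ⟨e, rfl⟩]

lemma bd_finite [Finite E] (s t : E → W) (F P : Set E) : (bd s t F P).Finite :=
  (verts_finite s t _).inter_of_left _

lemma bd_compl (s t : E → W) (F P : Set E) : bd s t F Pᶜ = bd s t F P := by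
  unfold bd
  rw [← Set.sdiff_eq, Set.sdiff_compl, Set.inter_comm]

/-- A property of separations that lifts every `P` with boundary control transfers `Bad`. -/
lemma Bad.lift {W' : Type*} {s t : E → W} {s' t' : E → W'} {F F' S : Set E}
    (h : Bad s' t' F' S) (hF : F ∩ S = F' ∩ S)
    (hP : ∀ P : Set E, ∃ P' : Set E, P' ∩ S = P ∩ S ∧
      (bd s t F P').ncard ≤ (bd s' t' F' P).ncard) : Bad s t F S := by
  obtain ⟨P, h⟩ := h
  obtain ⟨P', hS, hle⟩ := hP P
  have e1 : F ∩ P' ∩ S = F' ∩ P ∩ S := by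
    ext x
    have h1 := Set.ext_iff.1 hF x
    have h2 := Set.ext_iff.1 hS x
    simp only [Set.mem_inter_iff] at *
    tauto
  have e2 : F \ P' ∩ S = F' \ P ∩ S := by
    ext x
    have h1 := Set.ext_iff.1 hF x
    have h2 := Set.ext_iff.1 hS x
    simp only [Set.mem_inter_iff, Set.mem_sdiff] at *
    tauto
  refine ⟨P', ?_⟩
  rw [e1, e2]
  exact h.imp (fun h => ⟨hle.trans h.1, h.2⟩) (fun h => ⟨hle.trans h.1, h.2⟩)

/-- `Bad` computes the split separations of a multigraph whose edges embed in `E`. -/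
lemma badSplitSep_iff_bad {K : Multigraph} {s t : E → W} {i : K.E → E} {p : K.V → W}
    (hi : Function.Injective i) (hp : Function.Injective p)
    (hs : ∀ x, p (K.src x) = s (i x)) (ht : ∀ x, p (K.tgt x) = t (i x)) (S : Set E) :
    K.badSplitSep {x | i x ∈ S} ↔ Bad s t (Set.range i) S := by
  have hverts : ∀ A : Set K.E, verts s t (i '' A) = p '' K.edgeVerts A := by
    intro A
    ext w
    constructor
    · rintro ⟨_, ⟨x, hx, rfl⟩, hw | hw⟩
      · exact ⟨K.src x, ⟨x, hx, Or.inl rfl⟩, by rw [hs, hw]⟩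
      · exact ⟨K.tgt x, ⟨x, hx, Or.inr rfl⟩, by rw [ht, hw]⟩
    · rintro ⟨_, ⟨x, hx, rfl | rfl⟩, rfl⟩
      · exact ⟨i x, ⟨x, hx, rfl⟩, Or.inl (hs x)⟩
      · exact ⟨i x, ⟨x, hx, rfl⟩, Or.inr (ht x)⟩
  have hin : ∀ P : Set E, Set.range i ∩ P = i '' (i ⁻¹' P) := fun P => by
    rw [Set.image_preimage_eq_range_inter]
  have hout : ∀ P : Set E, Set.range i \ P = i '' (i ⁻¹' P)ᶜ := fun P => by
    rw [← Set.preimage_compl, Set.image_preimage_eq_range_inter, Set.sdiff_eq]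
  have hbd : ∀ P : Set E, (bd s t (Set.range i) P).ncard = K.sepOrder (i ⁻¹' P) := by
    intro P
    rw [bd, hin, hout, hverts, hverts, ← Set.image_inter hp,
      Set.ncard_image_of_injective _ hp, Multigraph.sepOrder]
  have hS : ∀ A : Set K.E, i '' A ∩ S = i '' (A ∩ {x | i x ∈ S}) := fun A =>
    (Set.image_inter_preimage i A S).symm
  have key : ∀ P : Set E,
      (((bd s t (Set.range i) P).ncard ≤ 1 ∧ (Set.range i ∩ P ∩ S).Nonempty ∧
          (Set.range i \ P ∩ S).Nonempty) ∨
        ((bd s t (Set.range i) P).ncard ≤ 2 ∧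
          min (Set.range i ∩ P ∩ S).ncard (Set.range i \ P ∩ S).ncard = 2)) ↔
      ((K.sepOrder (i ⁻¹' P) ≤ 1 ∧ (i ⁻¹' P ∩ {x | i x ∈ S}).Nonempty ∧
          ((i ⁻¹' P)ᶜ ∩ {x | i x ∈ S}).Nonempty) ∨
        (K.sepOrder (i ⁻¹' P) = 2 ∧
          min (i ⁻¹' P ∩ {x | i x ∈ S}).ncard ((i ⁻¹' P)ᶜ ∩ {x | i x ∈ S}).ncard = 2)) := by
    intro P
    rw [hbd, hin, hout, hS, hS, Set.image_nonempty, Set.image_nonempty,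
      Set.ncard_image_of_injective _ hi, Set.ncard_image_of_injective _ hi]
    constructor
    · rintro (h | ⟨h, hm⟩)
      · exact Or.inl h
      · rcases Nat.lt_or_ge (K.sepOrder (i ⁻¹' P)) 2 with hlt | hge
        · refine Or.inl ⟨by omega, ?_, ?_⟩
          · exact Set.nonempty_of_ncard_ne_zero (by omega)
          · exact Set.nonempty_of_ncard_ne_zero (by omega)
        · exact Or.inr ⟨le_antisymm h hge, hm⟩
    · rintro (h | ⟨h, hm⟩)
      · exact Or.inl h
      · exact Or.inr ⟨h.le, hm⟩
  constructor
  · rintro ⟨A, hA⟩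
    refine ⟨i '' A, (key _).2 ?_⟩
    rwa [Set.preimage_image_eq _ hi]
  · rintro ⟨P, hP⟩
    exact ⟨i ⁻¹' P, (key P).1 hP⟩

/-- Moving a set `M` containing all edges at `v` to the side `P`. -/
lemma bd_union_subset {s t : E → W} {F P M : Set E} {e : E} {u v : W} (heM : e ∈ M)
    (hends : ∀ y, (y = s e ∨ y = t e) → y = u ∨ y = v)
    (hvM : ∀ x ∈ F, (v = s x ∨ v = t x) → x ∈ M)
    (hM : ∀ x ∈ M, x ≠ e → ∀ y, y ≠ v → (y = s x ∨ y = t x) →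
      y ∈ verts s t ((F \ {e}) ∩ P))
    (hu : u ∈ bd (merge u v ∘ s) (merge u v ∘ t) (F \ {e}) P) :
    bd s t F (P ∪ M) ⊆ bd (merge u v ∘ s) (merge u v ∘ t) (F \ {e}) P := by
  rintro y ⟨⟨a, ha, hya⟩, ⟨b, hb, hyb⟩⟩
  have hyv : y ≠ v := by
    rintro rfl
    exact hb.2 (Or.inr (hvM b hb.1 hyb))
  by_cases hyu : y = u
  · rwa [hyu]
  have hae : a ≠ e := by
    rintro rfl
    exact (hends y hya).elim hyu hyv
  have hyP : y ∈ verts s t ((F \ {e}) ∩ P) := by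
    by_cases haM : a ∈ M
    · exact hM a haM hae y hyv hya
    · exact ⟨a, by grind, hya⟩
  obtain ⟨c, hc, hyc⟩ := hyP
  rw [← merge_of_ne (u := u) hyv]
  exact ⟨mem_verts_merge hc hyc, mem_verts_merge (by grind) hyb⟩

section Lifting

variable [Finite E] {s t : E → W} {F A S P M : Set E} {e : E} {u v : W}

lemma bad_of_delete_loop (he : e ∉ S) (hloop : s e = t e) (h : Bad s t (F \ {e}) S) :
    Bad s t F S := by
  refine h.lift (by grind) fun P => ?_
  by_cases hv : s e ∈ verts s t ((F \ {e}) ∩ P)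
  · refine ⟨P ∪ {e}, by grind, Set.ncard_le_ncard ?_ (bd_finite ..)⟩
    rintro y ⟨⟨a, ha, hya⟩, ⟨b, hb, hyb⟩⟩
    refine ⟨?_, ⟨b, by grind, hyb⟩⟩
    by_cases hae : a = e
    · subst hae
      have : y = s a := by grind
      rwa [this]
    · exact ⟨a, by grind, hya⟩
  · refine ⟨P \ {e}, by grind, Set.ncard_le_ncard ?_ (bd_finite ..)⟩
    rintro y ⟨⟨a, ha, hya⟩, ⟨b, hb, hyb⟩⟩
    have hy : y ∈ verts s t ((F \ {e}) ∩ P) := ⟨a, by grind, hya⟩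
    refine ⟨hy, ⟨b, ?_, hyb⟩⟩
    have : b ≠ e := by
      rintro rfl
      have : y = s b := by grind
      exact hv (this ▸ hy)
    grind

lemma bad_of_delete_parallel {e' : E} (he : e ∉ S) (he' : e' ∈ F) (hne : e ≠ e')
    (hpar : ∀ y, y = s e ∨ y = t e → y = s e' ∨ y = t e') (h : Bad s t (F \ {e}) S) :
    Bad s t F S := by
  refine h.lift (by grind) fun P => ?_
  by_cases hP : e' ∈ P
  · refine ⟨P ∪ {e}, by grind, Set.ncard_le_ncard ?_ (bd_finite ..)⟩
    rintro y ⟨⟨a, ha, hya⟩, ⟨b, hb, hyb⟩⟩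
    refine ⟨?_, ⟨b, by grind, hyb⟩⟩
    by_cases hae : a = e
    · exact ⟨e', by grind, hpar y (hae ▸ hya)⟩
    · exact ⟨a, by grind, hya⟩
  · refine ⟨P \ {e}, by grind, Set.ncard_le_ncard ?_ (bd_finite ..)⟩
    rintro y ⟨⟨a, ha, hya⟩, ⟨b, hb, hyb⟩⟩
    refine ⟨⟨a, by grind, hya⟩, ?_⟩
    by_cases hbe : b = e
    · exact ⟨e', by grind, hpar y (hbe ▸ hyb)⟩
    · exact ⟨b, by grind, hyb⟩

/-- If the contracted vertex is not in the boundary, the edge `e` joins the side of that vertex. -/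
lemma exists_lift_of_merged_notMem (heS : e ∉ S)
    (hends : ∀ y, (y = s e ∨ y = t e) → y = u ∨ y = v)
    (hu : u ∉ bd (merge u v ∘ s) (merge u v ∘ t) (F \ {e}) P) :
    ∃ P' : Set E, P' ∩ S = P ∩ S ∧ (bd s t F P').ncard ≤
      (bd (merge u v ∘ s) (merge u v ∘ t) (F \ {e}) P).ncard := by
  have huv : ∀ {y : W} {Q : Set E} {x : E}, (y = u ∨ y = v) → x ∈ Q → (y = s x ∨ y = t x) →
      u ∈ verts (merge u v ∘ s) (merge u v ∘ t) Q := by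
    intro y Q x hy hx hyx
    have := mem_verts_merge (u := u) (v := v) hx hyx
    rcases hy with rfl | rfl
    · rwa [merge_left] at this
    · rwa [merge_right] at this
  by_cases hP : u ∈ verts (merge u v ∘ s) (merge u v ∘ t) ((F \ {e}) ∩ P)
  · refine ⟨P ∪ {e}, by grind, Set.ncard_le_ncard ?_ (bd_finite ..)⟩
    rintro y ⟨⟨a, ha, hya⟩, ⟨b, hb, hyb⟩⟩
    have hb' : b ∈ (F \ {e}) \ P := by grind
    have hy : ¬ (y = u ∨ y = v) := fun hy => hu ⟨hP, huv hy hb' hyb⟩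
    have hae : a ≠ e := fun h => hy (hends y (h ▸ hya))
    have ha' : a ∈ (F \ {e}) ∩ P := by grind
    have hyv : y ≠ v := fun h => hy (Or.inr h)
    rw [← merge_of_ne (u := u) hyv]
    exact ⟨mem_verts_merge ha' hya, mem_verts_merge hb' hyb⟩
  · refine ⟨P \ {e}, by grind, Set.ncard_le_ncard ?_ (bd_finite ..)⟩
    rintro y ⟨⟨a, ha, hya⟩, ⟨b, hb, hyb⟩⟩
    have ha' : a ∈ (F \ {e}) ∩ P := by grind
    have hy : ¬ (y = u ∨ y = v) := fun hy => hP (huv hy ha' hya)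
    have hbe : b ≠ e := fun h => hy (hends y (h ▸ hyb))
    have hb' : b ∈ (F \ {e}) \ P := by grind
    have hyv : y ≠ v := fun h => hy (Or.inr h)
    rw [← merge_of_ne (u := u) hyv]
    exact ⟨mem_verts_merge ha' hya, mem_verts_merge hb' hyb⟩

/-- If a boundary vertex is not forced by the edges outside `A`, then all of `A` can be put on
one side. -/
lemma exists_lift_of_free_boundary (hAS : ∀ x ∈ A, x ∉ S) (heA : e ∈ A)
    (hv : v ∉ verts s t (F \ A)) (hX : (verts s t A ∩ verts s t (F \ A)).ncard ≤ 3) {z : W}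
    (hz : z ∈ bd (merge u v ∘ s) (merge u v ∘ t) (F \ {e}) P)
    (hzY : z ∉ bd s t (F \ A) P) :
    ∃ P' : Set E, P' ∩ S = P ∩ S ∧ (bd s t F P').ncard ≤
      (bd (merge u v ∘ s) (merge u v ∘ t) (F \ {e}) P).ncard := by
  set B2 := bd (merge u v ∘ s) (merge u v ∘ t) (F \ {e}) P with hB2
  set Y := bd s t (F \ A) P with hY
  set TP := verts s t ((F \ A) ∩ P) with hTP
  set TQ := verts s t ((F \ A) \ P) with hTQ
  have hYB : insert z Y ⊆ B2 := by
    refine Set.insert_subset hz ?_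
    rintro y ⟨⟨a, ha, hya⟩, ⟨b, hb, hyb⟩⟩
    have hyv : y ≠ v := by
      rintro rfl
      exact hv ⟨a, ha.1, hya⟩
    rw [← merge_of_ne (u := u) hyv]
    exact ⟨mem_verts_merge (by grind) hya, mem_verts_merge (by grind) hyb⟩
  have hcard : Y.ncard + 1 ≤ B2.ncard := by
    rw [← Set.ncard_insert_of_notMem hzY (bd_finite ..)]
    exact Set.ncard_le_ncard hYB (bd_finite ..)
  set X1 := verts s t A ∩ (TQ \ TP) with hX1
  set X2 := verts s t A ∩ (TP \ TQ) with hX2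
  have hTPf : TP.Finite := verts_finite ..
  have hTQf : TQ.Finite := verts_finite ..
  have hX1f : X1.Finite := (verts_finite s t A).inter_of_left _
  have hX2f : X2.Finite := (verts_finite s t A).inter_of_left _
  have hsum : X1.ncard + X2.ncard ≤ 3 := by
    have hdisj : Disjoint X1 X2 := Set.disjoint_left.2 fun x h1 h2 => h1.2.2 h2.2.1
    rw [← Set.ncard_union_eq hdisj hX1f hX2f]
    refine (Set.ncard_le_ncard ?_ ((verts_finite s t A).inter_of_left _)).trans hX
    rintro x (⟨hA, ⟨b, hb, hxb⟩, -⟩ | ⟨hA, ⟨b, hb, hxb⟩, -⟩)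
    · exact ⟨hA, b, hb.1, hxb⟩
    · exact ⟨hA, b, hb.1, hxb⟩
  have h1 : bd s t F (P ∪ A) ⊆ Y ∪ X1 := by
    rintro y ⟨⟨a, ha, hya⟩, ⟨b, hb, hyb⟩⟩
    have hyQ : y ∈ TQ := ⟨b, by grind, hyb⟩
    by_cases hyP : y ∈ TP
    · exact Or.inl ⟨hyP, hyQ⟩
    · refine Or.inr ⟨⟨a, ?_, hya⟩, hyQ, hyP⟩
      by_contra haA
      exact hyP ⟨a, by grind, hya⟩
  have h2 : bd s t F (P \ A) ⊆ Y ∪ X2 := by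
    rintro y ⟨⟨a, ha, hya⟩, ⟨b, hb, hyb⟩⟩
    have hyP : y ∈ TP := ⟨a, by grind, hya⟩
    by_cases hyQ : y ∈ TQ
    · exact Or.inl ⟨hyP, hyQ⟩
    · refine Or.inr ⟨⟨b, ?_, hyb⟩, hyP, hyQ⟩
      by_contra hbA
      exact hyQ ⟨b, by grind, hyb⟩
  have hYf : Y.Finite := bd_finite ..
  rcases Nat.lt_or_ge X1.ncard 2 with hlt | hge
  · refine ⟨P ∪ A, by grind, ?_⟩
    have := Set.ncard_le_ncard h1 (hYf.union hX1f)
    have := Set.ncard_union_le Y X1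
    omega
  · refine ⟨P \ A, by grind, ?_⟩
    have := Set.ncard_le_ncard h2 (hYf.union hX2f)
    have := Set.ncard_union_le Y X2
    omega

lemma exists_lift_of_side (hMS : ∀ x ∈ M, x ∉ S) (heM : e ∈ M)
    (hends : ∀ y, (y = s e ∨ y = t e) → y = u ∨ y = v)
    (hvM : ∀ x ∈ F, (v = s x ∨ v = t x) → x ∈ M)
    (hM : (∀ x ∈ M, x ≠ e → ∀ y, y ≠ v → (y = s x ∨ y = t x) →
        y ∈ verts s t ((F \ {e}) ∩ P)) ∨
      (∀ x ∈ M, x ≠ e → ∀ y, y ≠ v → (y = s x ∨ y = t x) →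
        y ∈ verts s t ((F \ {e}) ∩ Pᶜ)))
    (hu : u ∈ bd (merge u v ∘ s) (merge u v ∘ t) (F \ {e}) P) :
    ∃ P' : Set E, P' ∩ S = P ∩ S ∧ (bd s t F P').ncard ≤
      (bd (merge u v ∘ s) (merge u v ∘ t) (F \ {e}) P).ncard := by
  rcases hM with hM | hM
  · exact ⟨P ∪ M, by grind,
      Set.ncard_le_ncard (bd_union_subset heM hends hvM hM hu) (bd_finite ..)⟩
  · refine ⟨(Pᶜ ∪ M)ᶜ, by grind, Set.ncard_le_ncard ?_ (bd_finite ..)⟩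
    rw [← bd_compl _ _ _ P] at hu ⊢
    rw [bd_compl]
    exact bd_union_subset heM hends hvM hM hu

/-- Contracting the edge `e = uv`, where `v` meets only edges of `A`, preserves the absence of
bad separations, provided `u` meets only edges of `A`, or `v` has at most one further edge, or
`v` has two further edges whose other ends are linked in `A` avoiding `v`. -/
theorem bad_of_contract (hAS : ∀ x ∈ A, x ∉ S) (hAF : A ⊆ F) (heA : e ∈ A)
    (hends : ∀ y, (y = s e ∨ y = t e) ↔ y = u ∨ y = v)
    (hv : v ∉ verts s t (F \ A)) (hX : (verts s t A ∩ verts s t (F \ A)).ncard ≤ 3)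
    (hred : u ∉ verts s t (F \ A) ∨
      (∃ a ∈ A, ∀ x ∈ F, (v = s x ∨ v = t x) → x = e ∨ x = a) ∨
      ∃ a ∈ A, ∃ b ∈ A, ∃ g ∈ A, ∃ h ∈ A, ∃ p q : W,
        (∀ x ∈ F, (v = s x ∨ v = t x) → x = e ∨ x = a ∨ x = b) ∧
        (∀ y, (y = s a ∨ y = t a) ↔ y = v ∨ y = p) ∧
        (∀ y, (y = s b ∨ y = t b) ↔ y = v ∨ y = q) ∧
        (p = s g ∨ p = t g) ∧ (q = s h ∨ q = t h) ∧
        ¬ (v = s g ∨ v = t g) ∧ ¬ (v = s h ∨ v = t h) ∧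
        (g = h ∨ ∃ w, w ∉ verts s t (F \ A) ∧ (w = s g ∨ w = t g) ∧ (w = s h ∨ w = t h)))
    (h : Bad (merge u v ∘ s) (merge u v ∘ t) (F \ {e}) S) : Bad s t F S := by
  have heS : e ∉ S := hAS e heA
  refine h.lift (by grind) fun P => ?_
  by_cases hu : u ∈ bd (merge u v ∘ s) (merge u v ∘ t) (F \ {e}) P
  swap
  · exact exists_lift_of_merged_notMem heS (fun y => (hends y).1) hu
  by_cases hfree : ∃ z ∈ bd (merge u v ∘ s) (merge u v ∘ t) (F \ {e}) P, z ∉ bd s t (F \ A) P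
  · obtain ⟨z, hz, hzY⟩ := hfree
    exact exists_lift_of_free_boundary hAS heA hv hX hz hzY
  push Not at hfree
  have hbdA : ∀ z ∈ bd s t (F \ A) P, z ∈ verts s t (F \ A) :=
    fun z hz => verts_mono Set.inter_subset_left hz.1
  rcases hred with hu' | ⟨a, haA, hva⟩ | ⟨a, haA, b, hbA, g, hgA, k, hkA, p, q, hvab, ha, hb, hpg,
    hqk, hvg, hvk, hlink⟩
  · exact absurd (hbdA u (hfree u hu)) hu'
  · refine exists_lift_of_side (M := {e, a}) (by grind) (by simp) (fun y => (hends y).1)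
      (fun x hx hvx => hva x hx hvx) ?_ hu
    by_cases haP : a ∈ P
    · left
      intro x hx hxe y _ hy
      exact ⟨x, by grind, hy⟩
    · right
      intro x hx hxe y _ hy
      exact ⟨x, by grind, hy⟩
  · have hve : v = s e ∨ v = t e := (hends v).2 (Or.inr rfl)
    have hva : v = s a ∨ v = t a := (ha v).2 (Or.inl rfl)
    have hvb : v = s b ∨ v = t b := (hb v).2 (Or.inl rfl)
    have hge : g ≠ e := by rintro rfl; exact hvg hve
    have hke : k ≠ e := by rintro rfl; exact hvk hve
    have hside : g ∈ P ↔ k ∈ P := by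
      rcases hlink with rfl | ⟨w, hwA, hwg, hwk⟩
      · rfl
      by_contra hne
      have hwv : w ≠ v := by rintro rfl; exact hvg hwg
      have hwbd : w ∈ bd (merge u v ∘ s) (merge u v ∘ t) (F \ {e}) P := by
        rw [← merge_of_ne (u := u) hwv]
        by_cases hgP : g ∈ P
        · exact ⟨mem_verts_merge (x := g) (by grind) hwg, mem_verts_merge (x := k) (by grind) hwk⟩
        · exact ⟨mem_verts_merge (x := k) (by grind) hwk, mem_verts_merge (x := g) (by grind) hwg⟩
      exact hwA (hbdA w (hfree w hwbd))
    refine exists_lift_of_side (M := {e, a, b}) (by grind) (by simp) (fun y => (hends y).1)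
      (fun x hx hvx => hvab x hx hvx) ?_ hu
    have main : ∀ Q : Set E, g ∈ Q → k ∈ Q → ∀ x ∈ ({e, a, b} : Set E), x ≠ e → ∀ y, y ≠ v →
        (y = s x ∨ y = t x) → y ∈ verts s t ((F \ {e}) ∩ Q) := by
      intro Q hgQ hkQ x hx hxe y hyv hy
      rcases hx with rfl | rfl | rfl
      · exact absurd rfl hxe
      · obtain rfl := ((ha y).1 hy).resolve_left hyv
        exact ⟨g, ⟨⟨hAF hgA, hge⟩, hgQ⟩, hpg⟩
      · obtain rfl := ((hb y).1 hy).resolve_left hyv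
        exact ⟨k, ⟨⟨hAF hkA, hke⟩, hkQ⟩, hqk⟩
    by_cases hgP : g ∈ P
    · exact Or.inl (main P hgP (hside.1 hgP))
    · exact Or.inr (main Pᶜ hgP (mt hside.2 hgP))

end Lifting

end EdgeSep

namespace EdgeSep

lemma Bad.comp_injective {E W W' : Type*} {s t : E → W} {F S : Set E} {p : W → W'}
    (hp : Function.Injective p) (h : Bad s t F S) : Bad (p ∘ s) (p ∘ t) F S := by
  refine h.lift rfl fun P => ⟨P, rfl, ?_⟩
  have himage : ∀ Q : Set E, verts (p ∘ s) (p ∘ t) Q = p '' verts s t Q := by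
    intro Q
    ext w
    constructor
    · rintro ⟨x, hx, rfl | rfl⟩
      exacts [⟨s x, ⟨x, hx, Or.inl rfl⟩, rfl⟩, ⟨t x, ⟨x, hx, Or.inr rfl⟩, rfl⟩]
    · rintro ⟨_, ⟨x, hx, rfl | rfl⟩, rfl⟩
      exacts [⟨x, hx, Or.inl rfl⟩, ⟨x, hx, Or.inr rfl⟩]
  rw [bd, himage, himage, ← Set.image_inter hp, Set.ncard_image_of_injective _ hp, bd]

end EdgeSep

namespace Multigraph

variable (G : Multigraph)

/-- The relation identifying the ends of the edges in `C`. -/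
def contractRel (C : Set G.E) (a b : G.V) : Prop := ∃ e ∈ C, G.src e = a ∧ G.tgt e = b

/-- The projection to the vertex set after contraction of `C`. -/
def proj (C : Set G.E) (a : G.V) : Quot (G.contractRel C) := Quot.mk _ a

/-- After contracting `C` and keeping the edges in `F`, some separation splits `S`. -/
def BadMinor (C F S : Set G.E) : Prop := EdgeSep.Bad (G.proj C ∘ G.src) (G.proj C ∘ G.tgt) F S

variable {G}

lemma proj_eq_of_mem {C : Set G.E} {e : G.E} (he : e ∈ C) :
    G.proj C (G.src e) = G.proj C (G.tgt e) := Quot.sound ⟨e, he, rfl, rfl⟩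

lemma eq_of_proj_eq {C : Set G.E} {a v : G.V} (hv : v ∉ G.edgeVerts C)
    (h : G.proj C a = G.proj C v) : a = v := by
  have key := congrArg (Quot.lift (fun x => x = v) (by
    rintro x y ⟨e, he, rfl, rfl⟩
    refine propext (iff_of_false ?_ ?_)
    · rintro rfl
      exact hv ⟨e, he, Or.inl rfl⟩
    · rintro rfl
      exact hv ⟨e, he, Or.inr rfl⟩)) h
  exact key.mpr rfl

lemma edgeVerts_mono {C D : Set G.E} (h : C ⊆ D) : G.edgeVerts C ⊆ G.edgeVerts D :=
  fun _ ⟨e, he, hv⟩ => ⟨e, h he, hv⟩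

lemma verts_proj (C P : Set G.E) :
    EdgeSep.verts (G.proj C ∘ G.src) (G.proj C ∘ G.tgt) P = G.proj C '' G.edgeVerts P := by
  ext w
  constructor
  · rintro ⟨x, hx, rfl | rfl⟩
    exacts [⟨_, ⟨x, hx, Or.inl rfl⟩, rfl⟩, ⟨_, ⟨x, hx, Or.inr rfl⟩, rfl⟩]
  · rintro ⟨_, ⟨x, hx, rfl | rfl⟩, rfl⟩
    exacts [⟨x, hx, Or.inl rfl⟩, ⟨x, hx, Or.inr rfl⟩]

lemma badSplitSep_iff_badMinor (S : Set G.E) :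
    G.badSplitSep S ↔ G.BadMinor ∅ Set.univ S := by
  rw [← Set.range_id]
  refine EdgeSep.badSplitSep_iff_bad (i := id) (p := G.proj ∅) Function.injective_id
    (fun a b h => eq_of_proj_eq ?_ h) (fun _ => rfl) (fun _ => rfl) S
  rintro ⟨e, he, -⟩
  exact he

lemma minorDC_badSplitSep_iff (D C S : Set G.E) :
    (G.minorDC D C).badSplitSep {x | x.1 ∈ S} ↔ G.BadMinor C (D ∪ C)ᶜ S := by
  have hrange : (D ∪ C)ᶜ = Set.range (fun x : (G.minorDC D C).E => x.1) :=
    Subtype.range_coe.symm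
  rw [hrange]
  exact EdgeSep.badSplitSep_iff_bad (K := G.minorDC D C) (p := fun x => x)
    Subtype.val_injective (fun _ _ h => h) (fun _ => rfl) (fun _ => rfl) S

lemma badMinor_of_minorDC_minorDC {D C S : Set G.E} {D' C' : Set (G.minorDC D C).E}
    (h : ((G.minorDC D C).minorDC D' C').badSplitSep {x | x.1.1 ∈ S}) :
    G.BadMinor (C ∪ Subtype.val '' C')
      (Set.range fun x : ((G.minorDC D C).minorDC D' C').E => x.1.1) S := by
  let inner : (G.minorDC D C).V → Quot (G.contractRel (C ∪ Subtype.val '' C')) :=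
    Quot.lift (G.proj _) (by
      rintro a b ⟨e, he, rfl, rfl⟩
      exact proj_eq_of_mem (Or.inl he))
  let p : ((G.minorDC D C).minorDC D' C').V → Quot (G.contractRel (C ∪ Subtype.val '' C')) :=
    Quot.lift inner (by
      rintro a b ⟨e, he, rfl, rfl⟩
      exact proj_eq_of_mem (C := C ∪ Subtype.val '' C') (e := e.1) (Or.inr ⟨e, he, rfl⟩))
  let q : Quot (G.contractRel (C ∪ Subtype.val '' C')) → ((G.minorDC D C).minorDC D' C').V :=
    Quot.lift (fun a => Quot.mk _ (Quot.mk _ a)) (by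
      rintro a b ⟨e, he | ⟨x, hx, rfl⟩, rfl, rfl⟩
      · exact congrArg _ (Quot.sound ⟨e, he, rfl, rfl⟩)
      · exact Quot.sound ⟨x, hx, rfl, rfl⟩)
  have hqp : Function.LeftInverse q p := by
    rintro ⟨⟨a⟩⟩
    rfl
  exact (EdgeSep.badSplitSep_iff_bad (K := (G.minorDC D C).minorDC D' C') (p := p)
    (i := fun x => x.1.1) (fun x y hxy => Subtype.ext (Subtype.ext hxy)) hqp.injective
    (fun _ => rfl) (fun _ => rfl) S).1 h

lemma BadMinor.merge {C F S : Set G.E} {e : G.E} {u v : G.V} (he : G.ends e = s(u, v))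
    (h : G.BadMinor (insert e C) F S) :
    EdgeSep.Bad (EdgeSep.merge (G.proj C u) (G.proj C v) ∘ (G.proj C ∘ G.src))
      (EdgeSep.merge (G.proj C u) (G.proj C v) ∘ (G.proj C ∘ G.tgt)) F S := by
  have hends : (G.src e = u ∧ G.tgt e = v) ∨ (G.src e = v ∧ G.tgt e = u) := Sym2.eq_iff.1 he
  let p : Quot (G.contractRel (insert e C)) → Quot (G.contractRel C) :=
    Quot.lift (fun a => EdgeSep.merge (G.proj C u) (G.proj C v) (G.proj C a)) (by
      rintro a b ⟨x, rfl | hx, rfl, rfl⟩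
      · rcases hends with ⟨hs, ht⟩ | ⟨hs, ht⟩ <;>
          rw [hs, ht, EdgeSep.merge_left, EdgeSep.merge_right]
      · exact congrArg _ (proj_eq_of_mem hx))
  let q : Quot (G.contractRel C) → Quot (G.contractRel (insert e C)) :=
    Quot.lift (G.proj _) (by
      rintro a b ⟨x, hx, rfl, rfl⟩
      exact proj_eq_of_mem (Or.inr hx))
  have hquv : q (G.proj C u) = q (G.proj C v) := by
    have := proj_eq_of_mem (C := insert e C) (e := e) (Or.inl rfl)
    rcases hends with ⟨rfl, rfl⟩ | ⟨rfl, rfl⟩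
    exacts [this, this.symm]
  have hqm : ∀ x, q (EdgeSep.merge (G.proj C u) (G.proj C v) x) = q x := by
    intro x
    unfold EdgeSep.merge
    split_ifs with hx
    · rw [hx, hquv]
    · rfl
  have hqp : Function.LeftInverse q p := by
    rintro ⟨a⟩
    exact hqm (G.proj C a)
  exact EdgeSep.Bad.comp_injective (s := G.proj (insert e C) ∘ G.src)
    (t := G.proj (insert e C) ∘ G.tgt) (p := p) hqp.injective h

/-- The edge `e` of `A` can be contracted without affecting how `A` links the rest of `G`. -/
def Contractible (A : Set G.E) (e : G.E) : Prop :=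
  ∃ u v : G.V, G.ends e = s(u, v) ∧ v ∉ G.edgeVerts Aᶜ ∧
    (u ∉ G.edgeVerts Aᶜ ∨
      (∃ a ∈ A, ∀ x, G.inc v x → x = e ∨ x = a) ∨
      ∃ a ∈ A, ∃ b ∈ A, ∃ g ∈ A, ∃ h ∈ A, ∃ p q : G.V,
        (∀ x, G.inc v x → x = e ∨ x = a ∨ x = b) ∧
        G.ends a = s(v, p) ∧ G.ends b = s(v, q) ∧ G.inc p g ∧ G.inc q h ∧
        ¬ G.inc v g ∧ ¬ G.inc v h ∧
        (g = h ∨ ∃ w, w ∉ G.edgeVerts Aᶜ ∧ G.inc w g ∧ G.inc w h))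

section Reduction

variable {A C F S : Set G.E} {e : G.E}

lemma BadMinor.of_delete_loop (he : e ∉ S) (hloop : G.src e = G.tgt e)
    (h : G.BadMinor C (F \ {e}) S) : G.BadMinor C F S :=
  EdgeSep.bad_of_delete_loop he (congrArg (G.proj C) hloop) h

lemma BadMinor.of_delete_parallel {e' : G.E} (he : e ∉ S) (he' : e' ∈ F) (hne : e ≠ e')
    (hpar : G.ends e = G.ends e') (h : G.BadMinor C (F \ {e}) S) : G.BadMinor C F S := by
  refine EdgeSep.bad_of_delete_parallel he he' hne ?_ h
  rcases Sym2.eq_iff.1 hpar with ⟨h1, h2⟩ | ⟨h1, h2⟩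
  · simp only [Function.comp_apply, h1, h2]
    exact fun _ => id
  · simp only [Function.comp_apply, h1, h2]
    exact fun _ => Or.symm

lemma BadMinor.of_contract (hAS : ∀ x ∈ A, x ∉ S) (hAF : A ⊆ F) (hCA : C ⊆ Aᶜ) (heA : e ∈ A)
    (hA : G.sepOrder A ≤ 3) (hcon : G.Contractible A e)
    (h : G.BadMinor (insert e C) (F \ {e}) S) : G.BadMinor C F S := by
  obtain ⟨u, v, he, hv, hred⟩ := hcon
  have hinj : ∀ {x : G.V}, x ∉ G.edgeVerts Aᶜ → ∀ {y : G.V}, G.proj C y = G.proj C x → y = x :=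
    fun hx _ hy => eq_of_proj_eq (fun hxC => hx (edgeVerts_mono hCA hxC)) hy
  have hout : ∀ {x : G.V}, x ∉ G.edgeVerts Aᶜ →
      G.proj C x ∉ EdgeSep.verts (G.proj C ∘ G.src) (G.proj C ∘ G.tgt) (F \ A) := by
    intro x hx hmem
    rw [verts_proj] at hmem
    obtain ⟨y, hy, hyx⟩ := hmem
    rw [hinj hx hyx] at hy
    exact hx (edgeVerts_mono (fun _ hz => hz.2) hy)
  have hmap : ∀ {x : G.V} {a : G.E}, G.inc x a →
      (G.proj C x = (G.proj C ∘ G.src) a ∨ G.proj C x = (G.proj C ∘ G.tgt) a) :=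
    fun hx => hx.imp (congrArg _) (congrArg _)
  have hback : ∀ {x : G.V} {a : G.E}, x ∉ G.edgeVerts Aᶜ →
      (G.proj C x = (G.proj C ∘ G.src) a ∨ G.proj C x = (G.proj C ∘ G.tgt) a) → G.inc x a :=
    fun hx h => h.imp (fun h => (hinj hx h.symm).symm) (fun h => (hinj hx h.symm).symm)
  have hends : ∀ {a : G.E} {x y : G.V}, G.ends a = s(x, y) → ∀ z,
      (z = (G.proj C ∘ G.src) a ∨ z = (G.proj C ∘ G.tgt) a) ↔ z = G.proj C x ∨ z = G.proj C y := by
    intro a x y ha z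
    rcases Sym2.eq_iff.1 ha with ⟨h1, h2⟩ | ⟨h1, h2⟩
    · simp only [Function.comp_apply, h1, h2]
    · simp only [Function.comp_apply, h1, h2]
      exact or_comm
  refine EdgeSep.bad_of_contract hAS hAF heA (hends he) (hout hv) ?_ ?_ (h.merge he)
  · rw [verts_proj, verts_proj]
    refine (Set.ncard_le_ncard ?_ (Set.toFinite _)).trans
      ((Set.ncard_image_le (f := G.proj C) (Set.toFinite _)).trans hA)
    rintro _ ⟨⟨x, hx, rfl⟩, hy⟩
    by_cases hxA : x ∈ G.edgeVerts Aᶜ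
    · exact ⟨x, ⟨hx, hxA⟩, rfl⟩
    · rw [← verts_proj] at hy
      exact absurd hy (hout hxA)
  · rcases hred with hu | ⟨a, haA, ha⟩ | ⟨a, haA, b, hbA, g, hgA, k, hkA, p, q, hvab, ha, hb, hpg,
      hqk, hvg, hvk, hlink⟩
    · exact Or.inl (hout hu)
    · exact Or.inr (Or.inl ⟨a, haA, fun x _ hx => ha x (hback hv hx)⟩)
    · refine Or.inr (Or.inr ⟨a, haA, b, hbA, g, hgA, k, hkA, G.proj C p, G.proj C q,
        fun x _ hx => hvab x (hback hv hx), hends ha, hends hb, hmap hpg, hmap hqk,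
        fun h => hvg (hback hv h), fun h => hvk (hback hv h), ?_⟩)
      exact hlink.imp_right fun ⟨w, hw, hwg, hwk⟩ => ⟨G.proj C w, hout hw, hmap hwg, hmap hwk⟩

end Reduction

end Multigraph

namespace EGraph

variable {H : EGraph} {S : Set H.G.E}

/-- Contracting `C` and keeping the edges `F` is one of the operations in the definition of
splitting. -/
def Admissible (H : EGraph) (S C F : Set H.G.E) : Prop :=
  (C = ∅ ∧ F = Set.univ) ∨ (∃ f ∈ S \ H.Dp, C = ∅ ∧ F = {f}ᶜ) ∨
    ∃ f ∈ S \ H.Cp, C = {f} ∧ F = {f}ᶜ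

lemma Admissible.subset {C F : Set H.G.E} (h : H.Admissible S C F) : C ⊆ S := by
  rcases h with ⟨rfl, -⟩ | ⟨f, hf, rfl, -⟩ | ⟨f, hf, rfl, -⟩
  exacts [Set.empty_subset _, Set.empty_subset _, Set.singleton_subset_iff.2 hf.1]

lemma Admissible.compl_subset {C F : Set H.G.E} (h : H.Admissible S C F) : Sᶜ ⊆ F := by
  rcases h with ⟨-, rfl⟩ | ⟨f, hf, -, rfl⟩ | ⟨f, hf, -, rfl⟩
  · exact Set.subset_univ _
  · rintro x hx rfl
    exact hx hf.1
  · rintro x hx rfl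
    exact hx hf.1

lemma splits_of_badMinor {C F : Set H.G.E} (h : H.Admissible S C F) (hb : H.G.BadMinor C F S) :
    H.Splits S := by
  rcases h with ⟨rfl, rfl⟩ | ⟨f, hf, rfl, rfl⟩ | ⟨f, hf, rfl, rfl⟩
  · exact Or.inl ((badSplitSep_iff_badMinor S).2 hb)
  · refine Or.inr (Or.inl ⟨f, hf, (minorDC_badSplitSep_iff _ _ S).2 ?_⟩)
    rwa [Set.union_empty]
  · refine Or.inr (Or.inr ⟨f, hf, (minorDC_badSplitSep_iff _ _ S).2 ?_⟩)
    rwa [Set.empty_union]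

lemma badMinor_of_splits_minorDC {D C C₂ : Set H.G.E} {D' C' : Set (H.G.minorDC D C).E}
    {e f : H.G.E} (hDC : D ∪ C = {e}) (hDC' : ∀ x, x ∈ D' ∪ C' ↔ x.1 = f)
    (hC : C ∪ Subtype.val '' C' = C₂)
    (h : ((H.G.minorDC D C).minorDC D' C').badSplitSep {x | x.1.1 ∈ S}) :
    H.G.BadMinor C₂ ({f}ᶜ \ {e}) S := by
  have hrange : (Set.range fun x : ((H.G.minorDC D C).minorDC D' C').E => x.1.1) =
      {f}ᶜ \ {e} := by
    ext x
    constructor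
    · rintro ⟨⟨⟨y, hy⟩, hy'⟩, rfl⟩
      rw [hDC] at hy
      exact ⟨fun hyf => hy' ((hDC' _).2 hyf), hy⟩
    · rintro ⟨hxf, hxe⟩
      exact ⟨⟨⟨x, by rwa [hDC]⟩, fun hx => hxf ((hDC' _).1 hx)⟩, rfl⟩
  rw [← hC, ← hrange]
  exact badMinor_of_minorDC_minorDC h

lemma exists_badMinor_of_splits_delE {e : H.G.E} (h : (H.delE e).Splits {x | x.1 ∈ S}) :
    ∃ C F, H.Admissible S C F ∧ H.G.BadMinor C (F \ {e}) S := by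
  rcases h with h | ⟨f, hf, h⟩ | ⟨f, hf, h⟩
  · refine ⟨∅, Set.univ, Or.inl ⟨rfl, rfl⟩, ?_⟩
    have := (minorDC_badSplitSep_iff _ _ S).1 h
    rwa [Set.union_empty, Set.compl_eq_univ_sdiff] at this
  · exact ⟨∅, {f.1}ᶜ, Or.inr (Or.inl ⟨f.1, hf, rfl, rfl⟩),
      badMinor_of_splits_minorDC (Set.union_empty _)
        (fun x => (or_false _).to_iff.trans Subtype.ext_iff)
        ((Set.empty_union _).trans (Set.image_empty _)) h⟩
  · exact ⟨{f.1}, {f.1}ᶜ, Or.inr (Or.inr ⟨f.1, hf, rfl, rfl⟩),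
      badMinor_of_splits_minorDC (Set.union_empty _)
        (fun x => (false_or _).to_iff.trans Subtype.ext_iff)
        ((Set.empty_union _).trans Set.image_singleton) h⟩

lemma exists_badMinor_of_splits_conE {e : H.G.E} (h : (H.conE e).Splits {x | x.1 ∈ S}) :
    ∃ C F, H.Admissible S C F ∧ H.G.BadMinor (insert e C) (F \ {e}) S := by
  rcases h with h | ⟨f, hf, h⟩ | ⟨f, hf, h⟩
  · refine ⟨∅, Set.univ, Or.inl ⟨rfl, rfl⟩, ?_⟩
    have := (minorDC_badSplitSep_iff _ _ S).1 h
    rw [insert_empty_eq]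
    rwa [Set.empty_union, Set.compl_eq_univ_sdiff] at this
  · exact ⟨∅, {f.1}ᶜ, Or.inr (Or.inl ⟨f.1, hf, rfl, rfl⟩),
      badMinor_of_splits_minorDC (Set.empty_union _)
        (fun x => (or_false _).to_iff.trans Subtype.ext_iff)
        (congrArg _ (Set.image_empty _)) h⟩
  · exact ⟨{f.1}, {f.1}ᶜ, Or.inr (Or.inr ⟨f.1, hf, rfl, rfl⟩),
      badMinor_of_splits_minorDC (Set.empty_union _)
        (fun x => (false_or _).to_iff.trans Subtype.ext_iff)
        (congrArg _ Set.image_singleton) h⟩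

end EGraph

namespace Multigraph

variable {G : Multigraph} {A : Set G.E}

lemma exists_ends_eq {v : G.V} {e : G.E} (h : G.inc v e) : ∃ u, G.ends e = s(u, v) := by
  rcases h with rfl | rfl
  exacts [⟨_, Sym2.eq_swap⟩, ⟨_, rfl⟩]

lemma inc_of_ends_eq {u v x : G.V} {e : G.E} (h : G.ends e = s(u, v)) :
    G.inc x e ↔ x = u ∨ x = v := by
  rw [← Sym2.mem_iff, ← h]
  exact Sym2.mem_iff.symm

lemma mem_of_inc_of_notMem {v : G.V} {e : G.E} (hv : v ∉ G.edgeVerts Aᶜ) (h : G.inc v e) :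
    e ∈ A := by
  by_contra he
  exact hv ⟨e, he, h⟩

/-- Without contractible edges, an edge of `A` at a vertex `v` that meets only edges of `A` leads
to a boundary vertex. -/
lemma exists_ends_eq_of_not_contractible (hcon : ∀ e ∈ A, ¬ G.Contractible A e) {v : G.V}
    (hv : v ∉ G.edgeVerts Aᶜ) {e : G.E} (he : G.inc v e) :
    ∃ u ∈ G.edgeVerts A ∩ G.edgeVerts Aᶜ, G.ends e = s(u, v) := by
  obtain ⟨u, hu⟩ := exists_ends_eq he
  have heA := mem_of_inc_of_notMem hv he
  refine ⟨u, ⟨⟨e, heA, (inc_of_ends_eq hu).2 (Or.inl rfl)⟩, ?_⟩, hu⟩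
  by_contra huB
  exact hcon e heA ⟨u, v, hu, hv, Or.inl huB⟩

/-- Without parallel or contractible edges, a vertex that meets only edges of `A` has exactly three
edges, one to each vertex of a boundary of order three. -/
lemma star_of_not_contractible (hA : G.sepOrder A ≤ 3)
    (hpar : ∀ e ∈ A, ∀ e' ∈ A, G.ends e = G.ends e' → e = e')
    (hcon : ∀ e ∈ A, ¬ G.Contractible A e) {v : G.V} (hvA : v ∈ G.edgeVerts A)
    (hv : v ∉ G.edgeVerts Aᶜ) :
    (G.edgeVerts A ∩ G.edgeVerts Aᶜ).ncard = 3 ∧ {e | G.inc v e}.ncard = 3 ∧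
      ∀ x ∈ G.edgeVerts A ∩ G.edgeVerts Aᶜ, ∃ e ∈ A, G.ends e = s(x, v) := by
  have hX : (G.edgeVerts A ∩ G.edgeVerts Aᶜ).ncard ≤ 3 := hA
  have hother : ∀ e, ∃ u, G.inc v e →
      u ∈ G.edgeVerts A ∩ G.edgeVerts Aᶜ ∧ G.ends e = s(u, v) := by
    intro e
    by_cases he : G.inc v e
    · obtain ⟨u, hu⟩ := exists_ends_eq_of_not_contractible hcon hv he
      exact ⟨u, fun _ => hu⟩
    · exact ⟨v, fun h => absurd h he⟩
  choose u hu using hother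
  have hinj : Set.InjOn u {e | G.inc v e} := by
    intro e he e' he' heq
    refine hpar e (mem_of_inc_of_notMem hv he) e' (mem_of_inc_of_notMem hv he') ?_
    rw [(hu e he).2, (hu e' he').2, heq]
  have hsub : u '' {e | G.inc v e} ⊆ G.edgeVerts A ∩ G.edgeVerts Aᶜ := by
    rintro _ ⟨e, he, rfl⟩
    exact (hu e he).1
  have hcard := hinj.ncard_image
  have hle := Set.ncard_le_ncard hsub (Set.toFinite _)
  have hthree : 3 ≤ {e | G.inc v e}.ncard := by
    by_contra! hlt
    obtain ⟨e, heA, he⟩ := hvA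
    have hdiff := Set.ncard_sdiff_singleton_of_mem (s := {e | G.inc v e}) he
    have hone : ({e | G.inc v e} \ {e}).ncard ≤ 1 := by omega
    refine hcon e heA ⟨u e, v, (hu e he).2, hv, Or.inr (Or.inl ?_)⟩
    by_cases hne : ({e | G.inc v e} \ {e}).Nonempty
    · obtain ⟨a, ha⟩ := hne
      refine ⟨a, mem_of_inc_of_notMem hv ha.1, fun x hx => ?_⟩
      by_cases hxe : x = e
      · exact Or.inl hxe
      · exact Or.inr ((Set.ncard_le_one (Set.toFinite _)).1 hone x ⟨hx, hxe⟩ a ha)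
    · refine ⟨e, heA, fun x hx => Or.inl ?_⟩
      by_contra hxe
      exact hne ⟨x, hx, hxe⟩
  have heq : u '' {e | G.inc v e} = G.edgeVerts A ∩ G.edgeVerts Aᶜ :=
    Set.eq_of_subset_of_ncard_le hsub (by omega) (Set.toFinite _)
  refine ⟨by omega, by omega, fun x hx => ?_⟩
  rw [← heq] at hx
  obtain ⟨e, he, rfl⟩ := hx
  exact ⟨e, mem_of_inc_of_notMem hv he, (hu e he).2⟩

/-- A simple graph all of whose vertices lie on a boundary of order three has at most three
edges. -/
lemma ncard_le_three_of_edgeVerts_subset (hA : G.sepOrder A ≤ 3)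
    (hloop : ∀ e ∈ A, G.src e ≠ G.tgt e)
    (hpar : ∀ e ∈ A, ∀ e' ∈ A, G.ends e = G.ends e' → e = e')
    (hsub : G.edgeVerts A ⊆ G.edgeVerts Aᶜ) : A.ncard ≤ 3 := by
  set X := (G.edgeVerts A).toFinset with hX
  have hXcard : X.card ≤ 3 := by
    rw [hX, ← Set.ncard_eq_toFinset_card']
    rwa [sepOrder, Set.inter_eq_left.2 hsub] at hA
  have hmaps : ∀ e ∈ A.toFinset, ({G.src e, G.tgt e} : Finset G.V) ∈ X.powersetCard 2 := by
    intro e he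
    rw [Set.mem_toFinset] at he
    rw [Finset.mem_powersetCard, Finset.card_pair (hloop e he)]
    refine ⟨?_, rfl⟩
    intro x hx
    rw [hX, Set.mem_toFinset]
    exact ⟨e, he, by simpa [inc] using hx⟩
  have hinj : Set.InjOn (fun e => ({G.src e, G.tgt e} : Finset G.V)) A.toFinset := by
    intro e he e' he' heq
    refine hpar e (by simpa using he) e' (by simpa using he') ?_
    refine Sym2.ext fun x => ?_
    have := Finset.ext_iff.1 heq x
    simpa [ends] using this
  rw [Set.ncard_eq_toFinset_card']
  refine (Finset.card_le_card_of_injOn _ hmaps hinj).trans ?_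
  rw [Finset.card_powersetCard]
  exact Nat.choose_le_choose 2 hXcard

/-- Linking two of the three neighbours of `v` by edges of `A` off `v` makes the third edge at `v`
contractible. -/
lemma false_of_star (hcon : ∀ e ∈ A, ¬ G.Contractible A e)
    (hpar : ∀ e ∈ A, ∀ e' ∈ A, G.ends e = G.ends e' → e = e') {v r p q : G.V}
    (hv : v ∉ G.edgeVerts Aᶜ) (hX : G.edgeVerts A ∩ G.edgeVerts Aᶜ = {r, p, q})
    (hstar : ∀ x ∈ G.edgeVerts A ∩ G.edgeVerts Aᶜ, ∃ e ∈ A, G.ends e = s(x, v))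
    {g h : G.E} (hg : g ∈ A) (hh : h ∈ A) (hpg : G.inc p g) (hqh : G.inc q h)
    (hvg : ¬ G.inc v g) (hvh : ¬ G.inc v h)
    (hlink : g = h ∨ ∃ w, w ∉ G.edgeVerts Aᶜ ∧ G.inc w g ∧ G.inc w h) : False := by
  obtain ⟨e, heA, he⟩ := hstar r (by simp [hX])
  obtain ⟨a, haA, ha⟩ := hstar p (by simp [hX])
  obtain ⟨b, hbA, hb⟩ := hstar q (by simp [hX])
  refine hcon e heA ⟨r, v, he, hv, Or.inr (Or.inr ⟨a, haA, b, hbA, g, hg, h, hh, p, q, ?_,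
    ha.trans Sym2.eq_swap, hb.trans Sym2.eq_swap, hpg, hqh, hvg, hvh, hlink⟩)⟩
  intro x hx
  have hxA := mem_of_inc_of_notMem hv hx
  obtain ⟨u, hu, hxu⟩ := exists_ends_eq_of_not_contractible hcon hv hx
  rw [hX] at hu
  rcases hu with rfl | rfl | rfl
  · exact Or.inl (hpar x hxA e heA (hxu.trans he.symm))
  · exact Or.inr (Or.inl (hpar x hxA a haA (hxu.trans ha.symm)))
  · exact Or.inr (Or.inr (hpar x hxA b hbA (hxu.trans hb.symm)))

/-- A side with more than three edges of a separation of order at most three contains a loop, a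
parallel pair or a contractible edge. -/
theorem exists_reducible (hA : G.sepOrder A ≤ 3) (hcard : 3 < A.ncard) :
    ∃ e ∈ A, G.src e = G.tgt e ∨ (∃ e' ∈ A, e ≠ e' ∧ G.ends e = G.ends e') ∨
      G.Contractible A e := by
  by_contra! hno
  have hloop : ∀ e ∈ A, G.src e ≠ G.tgt e := fun e he => (hno e he).1
  have hpar : ∀ e ∈ A, ∀ e' ∈ A, G.ends e = G.ends e' → e = e' := by
    intro e he e' he' heq
    by_contra hne
    exact (hno e he).2.1 e' he' hne heq
  have hcon : ∀ e ∈ A, ¬ G.Contractible A e := fun e he => (hno e he).2.2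
  by_cases hsub : G.edgeVerts A ⊆ G.edgeVerts Aᶜ
  · exact absurd (ncard_le_three_of_edgeVerts_subset hA hloop hpar hsub) hcard.not_ge
  obtain ⟨v, hvA, hv⟩ := Set.not_subset.1 hsub
  obtain ⟨hX, hdeg, hstar⟩ := star_of_not_contractible hA hpar hcon hvA hv
  obtain ⟨g, hg, hvg⟩ : ∃ g ∈ A, ¬ G.inc v g := by
    by_contra! hall
    have := Set.ncard_le_ncard (show A ⊆ {e | G.inc v e} from hall) (Set.toFinite _)
    omega
  by_cases hgw : ∃ w, w ∉ G.edgeVerts Aᶜ ∧ G.inc w g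
  · obtain ⟨w, hw, hwg⟩ := hgw
    obtain ⟨-, -, hstar'⟩ := star_of_not_contractible hA hpar hcon ⟨g, hg, hwg⟩ hw
    have hvw : v ≠ w := by
      rintro rfl
      exact hvg hwg
    obtain ⟨r, p, q, -, -, -, hrpq⟩ := Set.ncard_eq_three.1 hX
    have hp : p ∈ G.edgeVerts A ∩ G.edgeVerts Aᶜ := by simp [hrpq]
    have hq : q ∈ G.edgeVerts A ∩ G.edgeVerts Aᶜ := by simp [hrpq]
    have hoff : ∀ {x : G.V} {k : G.E}, x ∈ G.edgeVerts A ∩ G.edgeVerts Aᶜ →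
        G.ends k = s(x, w) → ¬ G.inc v k := by
      intro x k hx hk hvk
      rcases (inc_of_ends_eq hk).1 hvk with rfl | h
      exacts [hv hx.2, hvw h]
    obtain ⟨k, hkA, hk⟩ := hstar' p hp
    obtain ⟨l, hlA, hl⟩ := hstar' q hq
    exact false_of_star hcon hpar hv hrpq hstar hkA hlA
      ((inc_of_ends_eq hk).2 (Or.inl rfl)) ((inc_of_ends_eq hl).2 (Or.inl rfl))
      (hoff hp hk) (hoff hq hl)
      (Or.inr ⟨w, hw, (inc_of_ends_eq hk).2 (Or.inr rfl), (inc_of_ends_eq hl).2 (Or.inr rfl)⟩)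
  · have hmem : ∀ x, G.inc x g → x ∈ G.edgeVerts A ∩ G.edgeVerts Aᶜ := by
      intro x hx
      refine ⟨⟨g, hg, hx⟩, ?_⟩
      by_contra hxB
      exact hgw ⟨x, hxB, hx⟩
    have hs := hmem _ (Or.inl rfl)
    have ht := hmem _ (Or.inr rfl)
    obtain ⟨r, hr⟩ : ∃ r, G.edgeVerts A ∩ G.edgeVerts Aᶜ = {r, G.src g, G.tgt g} := by
      have ht' : G.tgt g ∈ (G.edgeVerts A ∩ G.edgeVerts Aᶜ) \ {G.src g} :=
        ⟨ht, (hloop g hg).symm⟩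
      have hone := Set.ncard_sdiff_singleton_of_mem ht'
      rw [Set.ncard_sdiff_singleton_of_mem hs, hX] at hone
      obtain ⟨r, hr⟩ := Set.ncard_eq_one.1 hone
      refine ⟨r, ?_⟩
      rw [Set.insert_comm, Set.pair_comm, ← hr, Set.insert_sdiff_singleton,
        Set.insert_eq_of_mem ht', Set.insert_sdiff_singleton, Set.insert_eq_of_mem hs]
    exact false_of_star hcon hpar hv hr hstar hg hg (Or.inl rfl) (Or.inr rfl) hvg hvg (Or.inl rfl)

end Multigraph

namespace EGraph

variable {H : EGraph} {S : Set H.G.E}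

lemma splits_of_unprotC {f : H.G.E} (hf : f ∉ S) (h : (H.unprotC f).Splits S) : H.Splits S := by
  refine h.imp_right (Or.imp_right ?_)
  rintro ⟨f', hf', hbad⟩
  refine ⟨f', ⟨hf'.1, fun hC => hf'.2 ⟨hC, fun heq => hf ?_⟩⟩, hbad⟩
  exact heq ▸ hf'.1

lemma splits_of_unprotD {f : H.G.E} (hf : f ∉ S) (h : (H.unprotD f).Splits S) : H.Splits S := by
  refine h.imp_right (Or.imp_left ?_)
  rintro ⟨f', hf', hbad⟩
  refine ⟨f', ⟨hf'.1, fun hD => hf'.2 ⟨hD, fun heq => hf ?_⟩⟩, hbad⟩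
  exact heq ▸ hf'.1

lemma ncard_preimage_minorDC {D C : Set H.G.E} (h : Disjoint (D ∪ C) S) :
    {x : (H.G.minorDC D C).E | x.1 ∈ S}.ncard = S.ncard := by
  refine (Set.ncard_image_of_injective _ Subtype.val_injective).symm.trans (congrArg _ ?_)
  ext x
  constructor
  · rintro ⟨y, hy, rfl⟩
    exact hy
  · exact fun hx => ⟨⟨x, fun hxD => Set.disjoint_left.1 h hxD hx⟩, hx, rfl⟩

end EGraph

theorem stmt15 (H : EGraph) (S : Set H.G.E) (hS : S.ncard = 5) (hns : ¬ H.Splits S)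
    (hmin : ∀ H' : EGraph, Relation.TransGen EGraph.MinorStep H H' →
      ∀ S' : Set H'.G.E, S'.ncard = 5 → H'.Splits S') :
    (H.Cp ⊆ S ∧ H.Dp ⊆ S) ∧
      ∀ A : Set H.G.E, H.G.sepOrder A ≤ 3 → A ∩ S = ∅ → A.ncard ≤ 3 := by
  refine ⟨⟨fun f hf => ?_, fun f hf => ?_⟩, fun A hA hAS => ?_⟩
  · by_contra hfS
    exact hns (EGraph.splits_of_unprotC hfS (hmin _ (.single (.unprotC H f hf)) S hS))
  · by_contra hfS
    exact hns (EGraph.splits_of_unprotD hfS (hmin _ (.single (.unprotD H f hf)) S hS))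
  by_contra! hcard
  have hAS' : ∀ x ∈ A, x ∉ S := fun x hx hxS => hAS.le ⟨hx, hxS⟩
  obtain ⟨e, heA, hred⟩ := exists_reducible hA hcard
  have heS := hAS' e heA
  have hdel : ∃ C F, H.Admissible S C F ∧ H.G.BadMinor C (F \ {e}) S :=
    EGraph.exists_badMinor_of_splits_delE (hmin _ (.single (.delE H e)) {x | x.1 ∈ S}
      ((EGraph.ncard_preimage_minorDC (by simpa using heS)).trans hS))
  rcases hred with hloop | ⟨e', he', hne, hpar⟩ | hcon
  · obtain ⟨C, F, hadm, hbad⟩ := hdel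
    exact hns (EGraph.splits_of_badMinor hadm (hbad.of_delete_loop heS hloop))
  · obtain ⟨C, F, hadm, hbad⟩ := hdel
    exact hns (EGraph.splits_of_badMinor hadm
      (hbad.of_delete_parallel heS (hadm.compl_subset (hAS' e' he')) hne hpar))
  · obtain ⟨C, F, hadm, hbad⟩ := EGraph.exists_badMinor_of_splits_conE
      (hmin _ (.single (.conE H e)) {x | x.1 ∈ S}
        ((EGraph.ncard_preimage_minorDC (by simpa using heS)).trans hS))
    exact hns (EGraph.splits_of_badMinor hadm (hbad.of_contract hAS'
      (fun x hx => hadm.compl_subset (hAS' x hx)) (fun x hx hxA => hAS' x hxA (hadm.subset hx))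
      heA hA hcon))
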